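/- arXiv:1402.5122 — 2 statements merged into one kernel-verified Lean document; each statement's English description precedes it below -/
import Mathlib

section
/- Let R be a noetherian integral domain with fraction field K, A a finite free R-algebra, and p a nonzero prime ideal of R such that the fiber A(p) = k(p) ⊗_R A is split. Then dim_{k(p)} Jac(A(p)) ≥ dim_K Jac(A^K). -/
open TensorProduct

/-- A `K`-algebra `A` is split if the endomorphisms of every simple `A`-module are just the
scalars from `K`. -/
def IsSplit (K : Type) (A : Type) [CommRing K] [Ring A] [Algebra K A] : Prop :=
  ∀ (S : Type) (_ : AddCommGroup S) (_ : Module A S), IsSimpleModule A S →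
    ∀ f : S →ₗ[A] S, ∃ c : K, ∀ x : S, f x = algebraMap K A c • x

/-- dimension of the Jacobson radical -/
noncomputable abbrev jdim (K B : Type) [Field K] [Ring B] [Algebra K B] : ℕ :=
  Module.finrank K ((Ideal.jacobson (⊥ : Ideal B)).restrictScalars K)

lemma jdim_congr {K B C : Type} [Field K] [Ring B] [Algebra K B] [Ring C] [Algebra K C]
    (e : B ≃ₐ[K] C) : jdim K B = jdim K C := by
  have h : ((Ideal.jacobson (⊥ : Ideal B)).restrictScalars K).map (e.toLinearEquiv : B →ₗ[K] C)
      = (Ideal.jacobson (⊥ : Ideal C)).restrictScalars K := by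
    have h1 := Ideal.map_jacobson_of_bijective (I := (⊥ : Ideal B)) (f := (e : B →+* C)) e.bijective
    rw [Ideal.map_bot] at h1
    ext x
    rw [Submodule.restrictScalars_mem, ← h1,
      Ideal.mem_map_iff_of_surjective (e : B →+* C) e.surjective]
    exact Iff.rfl
  unfold jdim
  rw [← h]
  exact (LinearEquiv.finrank_eq (e.toLinearEquiv.submoduleMap _))

noncomputable def cbc (R S T B : Type) [CommRing R] [CommRing S] [CommRing T] [Ring B]
    [Algebra R S] [Algebra R T] [Algebra S T] [IsScalarTower R S T] [Algebra R B] :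
    T ⊗[R] B ≃ₐ[T] T ⊗[S] (S ⊗[R] B) :=
  Algebra.TensorProduct.algEquivOfLinearEquivTensorProduct
    (AlgebraTensorModule.cancelBaseChange R S T T B).symm
    (by intros; simp) (by simp [Algebra.TensorProduct.one_def])

lemma mem_jac_of_nil {B : Type} [Ring B] (x : B) (h : ∀ y : B, IsNilpotent (y * x)) :
    x ∈ Ideal.jacobson (⊥ : Ideal B) := by
  rw [Ideal.mem_jacobson_iff]
  intro y
  obtain ⟨u, hu⟩ := (h y).isUnit_one_add
  refine ⟨↑u⁻¹, ?_⟩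
  have : (↑u⁻¹ : B) * (1 + y * x) = 1 := by rw [← hu]; simp
  rw [mul_add, mul_one, ← mul_assoc] at this
  rw [add_comm, this]; simp

lemma valuation_case (O K k B : Type) [CommRing O] [IsDomain O] [ValuationRing O]
    [Field K] [Algebra O K] [IsFractionRing O K] [Field k] [Algebra O k]
    [Ring B] [Algebra O B] [Module.Free O B] [Module.Finite O B] :
    jdim K (K ⊗[O] B) ≤ jdim k (k ⊗[O] B) := by
  have : IsArtinianRing (K ⊗[O] B) := IsArtinianRing.of_finite K _
  set J := Ideal.jacobson (⊥ : Ideal (K ⊗[O] B)) with hJ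
  have hJtwo : J.IsTwoSided := by rw [hJ]; infer_instance
  let i : B →ₐ[O] K ⊗[O] B := Algebra.TensorProduct.includeRight
  have hi : Function.Injective i :=
    Algebra.TensorProduct.includeRight_injective (IsFractionRing.injective O K)
  let JK : Submodule K (K ⊗[O] B) := J.restrictScalars K
  let q : B →ₗ[O] (K ⊗[O] B) ⧸ JK := (JK.mkQ.restrictScalars O) ∘ₗ i.toLinearMap
  let M := LinearMap.range q
  let N := LinearMap.ker q
  have hN : ∀ b, b ∈ N ↔ i b ∈ J := by
    intro b
    simp [N, q, JK]
  have hMfin : Module.Finite O M := inferInstance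
  have hTF : Module.IsTorsionFree O ((K ⊗[O] B) ⧸ JK) := Module.IsTorsionFree.trans_faithfulSMul O K _
  have hflat : Module.Flat O M := by
    rw [Module.Flat.flat_iff_torsion_eq_bot_of_isBezout,
      ← Submodule.isTorsionFree_iff_torsion_eq_bot]
    infer_instance
  have hfree : Module.Free O M := Module.free_of_flat_of_isLocalRing
  have hrank : Module.finrank O M ≤ Module.finrank K ((K ⊗[O] B) ⧸ JK) := by
    let b := Module.Free.chooseBasis O M
    have h1 : LinearIndependent O (fun j => (b j : (K ⊗[O] B) ⧸ JK)) :=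
      b.linearIndependent.map' M.subtype (by simp)
    rw [LinearIndependent.iff_fractionRing O K] at h1
    rw [Module.finrank_eq_card_chooseBasisIndex]
    exact h1.fintype_card_le_finrank
  let ψ : k ⊗[O] B →ₗ[k] k ⊗[O] M := q.rangeRestrict.baseChange k
  have hker : ∀ x, ψ x = 0 → x ∈ N.baseChange k := by
    intro x hx
    have he : Function.Exact N.subtype q.rangeRestrict := by
      rw [LinearMap.exact_iff, LinearMap.ker_rangeRestrict]; simp [N]
    obtain ⟨y, hy⟩ := (lTensor_exact k he q.surjective_rangeRestrict x).1 hx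
    rw [← hy]
    exact ⟨y, rfl⟩
  obtain ⟨r, hr⟩ : IsNilpotent J := IsArtinianRing.isNilpotent_jacobson_bot
  have hNr : N ^ r = ⊥ := by
    have h1 : ∀ j, ∀ b ∈ N ^ j, i b ∈ J ^ j := by
      intro j
      induction j with
      | zero => intro b _; rw [Submodule.pow_zero, Ideal.one_eq_top]; trivial
      | succ j ih =>
        intro b hb
        rw [pow_succ] at hb
        rw [Submodule.pow_succ]
        induction hb using Submodule.mul_induction_on' with
        | mem_mul_mem m hm n hn =>
          rw [map_mul]; exact Ideal.mul_mem_mul (ih m hm) ((hN n).1 hn)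
        | add x _ y _ hx hy => rw [map_add]; exact add_mem hx hy
    rw [eq_bot_iff]
    intro b hb
    have := h1 r b hb
    rw [hr] at this
    exact hi (by simpa using this)
  have hPr : (N.baseChange k) ^ r = ⊥ := by
    rw [Submodule.baseChange_eq_span, Submodule.span_pow, eq_bot_iff, Submodule.span_le]
    have : ((Submodule.map (TensorProduct.mk O k B 1) N : Submodule O (k ⊗[O] B)) : Set (k ⊗[O] B)) =
      (Algebra.TensorProduct.includeRight : B →ₐ[O] k ⊗[O] B) '' N := rfl
    rw [this, ← Set.image_pow]
    rintro _ ⟨b, hb, rfl⟩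
    have : b ∈ N ^ r := Submodule.pow_subset_pow _ hb
    rw [hNr] at this
    simp at this
    simp [this]
  have hle : LinearMap.ker ψ ≤ (Ideal.jacobson (⊥ : Ideal (k ⊗[O] B))).restrictScalars k := by
    intro x hx
    rw [Submodule.restrictScalars_mem]
    apply mem_jac_of_nil
    intro y
    have hyx : y * x ∈ N.baseChange k := by
      replace hx := hker x hx
      have hsm : ∀ c b, b ∈ N → c * b ∈ N := by
        intro c b hb
        rw [hN] at hb ⊢
        rw [map_mul]; exact J.mul_mem_left _ hb
      induction y with
      | zero => simp
      | add y z hy hz => rw [add_mul]; exact add_mem hy hz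
      | tmul a c =>
        rw [Submodule.baseChange_eq_span] at hx ⊢
        induction hx using Submodule.span_induction with
        | zero => simp
        | add y z _ _ hy hz => rw [mul_add]; exact add_mem hy hz
        | smul t y _ hy => rw [mul_smul_comm]; exact Submodule.smul_mem _ _ hy
        | mem y hy =>
          obtain ⟨b, hb, rfl⟩ := hy
          have : (a ⊗ₜ[O] c) * (TensorProduct.mk O k B 1 b) = a • (TensorProduct.mk O k B 1 (c * b)) := by
            simp [TensorProduct.smul_tmul']
          rw [this]
          exact Submodule.smul_mem _ _ (Submodule.subset_span ⟨_, hsm _ _ hb, rfl⟩)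
    refine ⟨r, ?_⟩
    have := Submodule.pow_mem_pow _ hyx r
    rw [hPr] at this
    simpa using this
  have h1 := Submodule.finrank_mono hle
  have h2 := LinearMap.finrank_range_add_finrank_ker ψ
  have h3 : Module.finrank k (LinearMap.range ψ) ≤ Module.finrank k (k ⊗[O] M) :=
    Submodule.finrank_le _
  have h4 := Submodule.finrank_quotient_add_finrank JK
  rw [Module.finrank_baseChange] at h2 h3 h4
  change Module.finrank K JK ≤ _
  unfold jdim
  omega

lemma isSplit_quot (κ B C : Type) [Field κ] [Ring B] [Algebra κ B] [Ring C] [Algebra κ C]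
    (π : B →ₐ[κ] C) (hπ : Function.Surjective π) (h : IsSplit κ B) : IsSplit κ C := by
  intro S _ _ hS f
  let : Module B S := Module.compHom S (π : B →+* C)
  have hsm : ∀ (b : B) (x : S), b • x = π b • x := fun _ _ => rfl
  have hsimp : IsSimpleModule B S := by
    rw [isSimpleModule_iff_toSpanSingleton_surjective] at hS ⊢
    refine ⟨hS.1, fun x hx y => ?_⟩
    obtain ⟨c, hc⟩ := hS.2 x hx y
    obtain ⟨b, rfl⟩ := hπ c
    exact ⟨b, hc⟩
  obtain ⟨c, hc⟩ := h S inferInstance inferInstance hsimp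
    { toFun := f, map_add' := map_add _, map_smul' := fun b x => by
        rw [hsm, map_smul]; rfl }
  refine ⟨c, fun x => ?_⟩
  have := hc x
  rw [hsm, AlgHom.commutes] at this
  exact this

lemma split_semisimple (κ L C : Type) [Field κ] [Field L] [Algebra κ L] [Ring C] [Algebra κ C]
    [IsSemisimpleRing C] (h : IsSplit κ C) : IsSemisimpleRing (L ⊗[κ] C) := by
  obtain ⟨n, S, d, hS, hd, ⟨e⟩⟩ :=
    IsSemisimpleRing.exists_algEquiv_pi_matrix_end_mulOpposite κ C
  have hend : ∀ i, Function.Bijective (algebraMap κ (Module.End C (S i))ᵐᵒᵖ) := by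
    intro i
    have := hS i
    have : Nontrivial (S i) := IsSimpleModule.nontrivial C _
    refine ⟨(algebraMap κ _).injective, fun f => ?_⟩
    obtain ⟨c, hc⟩ := h (S i) inferInstance inferInstance (hS i) f.unop
    refine ⟨c, ?_⟩
    apply MulOpposite.unop_injective
    ext1 x
    rw [hc]
    simp [MulOpposite.algebraMap_apply]
  let eM : C ≃ₐ[κ] Π i, Matrix (Fin (d i)) (Fin (d i)) κ :=
    e.trans (AlgEquiv.piCongrRight fun i =>
      (AlgEquiv.ofBijective (Algebra.ofId κ (Module.End C (S i))ᵐᵒᵖ) (hend i)).symm.mapMatrix)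
  let eL : L ⊗[κ] C ≃+* Π i, Matrix (Fin (d i)) (Fin (d i)) L :=
    ((Algebra.TensorProduct.congr (AlgEquiv.refl (R := κ) (A₁ := L)) eM).trans
      ((Algebra.TensorProduct.piRight κ κ L _).trans
        (AlgEquiv.piCongrRight fun i => (matrixEquivTensor (Fin (d i)) κ L).symm))).toRingEquiv
  exact eL.symm.isSemisimpleRing

lemma split_aux (κ L B C : Type) [Field κ] [Field L] [Algebra κ L] [Ring B] [Algebra κ B]
    [Module.Finite κ B] [Ring C] [Algebra κ C] [IsSemisimpleRing (L ⊗[κ] C)]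
    (π : B →ₐ[κ] C) (hπ : Function.Surjective π) :
    jdim L (L ⊗[κ] B) + Module.finrank κ C ≤ Module.finrank κ B := by
  let φ : L ⊗[κ] B →ₐ[L] L ⊗[κ] C := Algebra.TensorProduct.map (AlgHom.id L L) π
  have hφ : Function.Surjective φ := by
    intro y
    induction y with
    | zero => exact ⟨0, map_zero _⟩
    | add y z hy hz =>
      obtain ⟨a, rfl⟩ := hy
      obtain ⟨b, rfl⟩ := hz
      exact ⟨a + b, map_add _ _ _⟩
    | tmul l c =>
      obtain ⟨b, rfl⟩ := hπ c
      exact ⟨l ⊗ₜ b, by simp [φ]⟩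
  have hle : (Ideal.jacobson (⊥ : Ideal (L ⊗[κ] B))).restrictScalars L ≤
      LinearMap.ker φ.toLinearMap := by
    intro x hx
    rw [Submodule.restrictScalars_mem, Ideal.jacobson_bot] at hx
    have : RingHomSurjective (φ : L ⊗[κ] B →+* L ⊗[κ] C) := ⟨hφ⟩
    have := Ring.le_comap_jacobson (φ : L ⊗[κ] B →+* L ⊗[κ] C) hx
    rw [IsSemisimpleRing.jacobson_eq_bot] at this
    simpa using this
  have h1 := Submodule.finrank_mono hle
  have h2 := LinearMap.finrank_range_add_finrank_ker φ.toLinearMap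
  have hr : LinearMap.range φ.toLinearMap = ⊤ := LinearMap.range_eq_top.2 hφ
  rw [hr, finrank_top, Module.finrank_baseChange,
    Module.finrank_baseChange] at h2
  unfold jdim
  omega

lemma split_case (κ L B : Type) [Field κ] [Field L] [Algebra κ L] [Ring B] [Algebra κ B]
    [Module.Finite κ B] (h : IsSplit κ B) : jdim L (L ⊗[κ] B) ≤ jdim κ B := by
  have : IsArtinianRing B := IsArtinianRing.of_finite κ _
  have : IsArtinianRing (B ⧸ Ring.jacobson B) := IsArtinianRing.of_finite κ _
  have hss : IsSemisimpleRing (B ⧸ Ring.jacobson B) := by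
    rw [IsArtinianRing.isSemisimpleRing_iff_jacobson]
    exact Ring.jacobson_quotient_jacobson B
  have hssL : IsSemisimpleRing (L ⊗[κ] (B ⧸ Ring.jacobson B)) := split_semisimple κ L _
    (isSplit_quot κ B _ (Ideal.Quotient.mkₐ κ (Ring.jacobson B)) Ideal.Quotient.mk_surjective h)
  have h1 := split_aux κ L B _ (Ideal.Quotient.mkₐ κ (Ring.jacobson B))
    Ideal.Quotient.mk_surjective
  have h2 := LinearMap.finrank_range_add_finrank_ker
    (Ideal.Quotient.mkₐ κ (Ring.jacobson B)).toLinearMap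
  rw [LinearMap.range_eq_top.2 Ideal.Quotient.mk_surjective, finrank_top] at h2
  have h3 : LinearMap.ker (Ideal.Quotient.mkₐ κ (Ring.jacobson B)).toLinearMap =
      (Ideal.jacobson (⊥ : Ideal B)).restrictScalars κ := by
    ext x
    rw [Submodule.restrictScalars_mem, Ideal.jacobson_bot, LinearMap.mem_ker]
    exact Ideal.Quotient.eq_zero_iff_mem
  rw [h3] at h2
  change _ ≤ Module.finrank κ ((Ideal.jacobson (⊥ : Ideal B)).restrictScalars κ)
  rw [← h2, add_comm] at h1
  exact le_of_add_le_add_left h1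

lemma combine (R O K k κ A : Type) [CommRing R] [CommRing O] [IsDomain O] [ValuationRing O]
    [Field K] [Field k] [Field κ] [Algebra R O] [Algebra R K] [Algebra O K] [IsScalarTower R O K]
    [IsFractionRing O K] [Algebra R k] [Algebra O k] [IsScalarTower R O k]
    [Algebra R κ] [Algebra κ k] [IsScalarTower R κ k]
    [Ring A] [Algebra R A] [Module.Free R A] [Module.Finite R A] (h : IsSplit κ (κ ⊗[R] A)) :
    jdim K (K ⊗[R] A) ≤ jdim κ (κ ⊗[R] A) := by
  calc _ = jdim K (K ⊗[O] (O ⊗[R] A)) := jdim_congr (cbc ..)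
    _ ≤ jdim k (k ⊗[O] (O ⊗[R] A)) := valuation_case ..
    _ = jdim k (k ⊗[R] A) := (jdim_congr (cbc ..)).symm
    _ = jdim k (k ⊗[κ] (κ ⊗[R] A)) := jdim_congr (cbc ..)
    _ ≤ _ := split_case _ _ _ h

/-- Let `R` be a noetherian integral domain with fraction field `K`, `A` a
finite free `R`-algebra, `p` a nonzero prime of `R` with residue field `κ = Frac(R/p)`.
If the fibre `A(p) = κ ⊗[R] A` is split, then `dim_κ Jac(A(p)) ≥ dim_K Jac(A^K)`. -/
theorem jacobson_dim_fiber_ge_of_noetherian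
    (R : Type) [CommRing R] [IsDomain R] [IsNoetherianRing R]
    (K : Type) [Field K] [Algebra R K] [IsFractionRing R K]
    (A : Type) [Ring A] [Algebra R A] [Module.Free R A] [Module.Finite R A]
    (p : Ideal R) (hp : p.IsPrime) (hp0 : p ≠ ⊥)
    (κ : Type) [Field κ] [Algebra (R ⧸ p) κ] [IsFractionRing (R ⧸ p) κ] :
    letI : Algebra R κ := ((algebraMap (R ⧸ p) κ).comp (Ideal.Quotient.mk p)).toAlgebra
    IsSplit κ (κ ⊗[R] A) →
      Module.finrank κ ((Ideal.jacobson (⊥ : Ideal (κ ⊗[R] A))).restrictScalars κ) ≥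
        Module.finrank K ((Ideal.jacobson (⊥ : Ideal (K ⊗[R] A))).restrictScalars K) := by
  let : Algebra R κ := ((algebraMap (R ⧸ p) κ).comp (Ideal.Quotient.mk p)).toAlgebra
  intro h
  let Rp := Localization.AtPrime p
  let f : Rp →+* K := IsLocalization.lift (M := p.primeCompl) (g := algebraMap R K) (by
    rintro ⟨x, hx⟩
    have : x ≠ 0 := by rintro rfl; exact hx p.zero_mem
    simpa using this)
  obtain ⟨V, hV, hloc⟩ := IsLocalRing.exists_factor_valuationRing f
  let g : R →+* V := (f.codRestrict V.toSubring hV).comp (algebraMap R Rp)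
  letI : Algebra R V := g.toAlgebra
  haveI : IsScalarTower R V K := IsScalarTower.of_algebraMap_eq fun x => by
    change algebraMap R K x = f (algebraMap R Rp x)
    simp [f]
  let k := IsLocalRing.ResidueField V
  letI : Algebra R k := ((algebraMap V k).comp g).toAlgebra
  haveI : IsScalarTower R V k := IsScalarTower.of_algebraMap_eq fun x => rfl
  have hg : ∀ x, algebraMap R k x = 0 ↔ x ∈ p := by
    intro x
    change IsLocalRing.residue V (g x) = 0 ↔ _
    rw [IsLocalRing.residue_eq_zero_iff, IsLocalRing.mem_maximalIdeal, mem_nonunits_iff]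
    change ¬ IsUnit ((f.codRestrict V.toSubring hV) (algebraMap R Rp x)) ↔ _
    rw [isUnit_map_iff, IsLocalization.AtPrime.isUnit_to_map_iff Rp p]
    simp [Ideal.primeCompl]
  let t : R ⧸ p →+* k := Ideal.Quotient.lift p (algebraMap R k) fun a ha => (hg a).2 ha
  have ht : Function.Injective t := by
    rw [injective_iff_map_eq_zero]
    intro a ha
    obtain ⟨a, rfl⟩ := Ideal.Quotient.mk_surjective a
    rw [Ideal.Quotient.eq_zero_iff_mem, ← hg]
    simpa [t] using ha
  letI : Algebra κ k := (IsFractionRing.lift ht : κ →+* k).toAlgebra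
  haveI : IsScalarTower R κ k := IsScalarTower.of_algebraMap_eq fun x => by
    change _ = (IsFractionRing.lift ht : κ →+* k) (algebraMap (R ⧸ p) κ (Ideal.Quotient.mk p x))
    rw [IsFractionRing.lift_algebraMap]
    simp [t]
  exact combine R V K k κ A h
end

section
/- Let O be a valuation ring with maximal ideal m and fraction field K, let A be a finite free O-algebra, and let Ṽ, W̃ be two O-free A-forms of the same finite-dimensional A^K-module V. Then [Ṽ/mṼ] = [W̃/mW̃] in the Grothendieck group G₀(A(m)) of the special fiber A(m) = (O/m) ⊗_O A, i.e., the two reductions have the same composition factors with multiplicities. -/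
/-- The type of finite-length modules over the ring `A`. -/
def FLModuleCat (A : Type) [Ring A] : Type 1 :=
  {M : ModuleCat.{0} A // IsFiniteLength A M}

/-- The subgroup of relations coming from short exact sequences `0 → U → V → W → 0` of
finite-length `A`-modules. -/
def G0Rels (A : Type) [Ring A] : AddSubgroup (FreeAbelianGroup (FLModuleCat A)) :=
  AddSubgroup.closure
    {x | ∃ (U V W : FLModuleCat A) (f : ↑U.1 →ₗ[A] ↑V.1) (g : ↑V.1 →ₗ[A] ↑W.1),
      Function.Injective f ∧ Function.Surjective g ∧ LinearMap.range f = LinearMap.ker g ∧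
      x = FreeAbelianGroup.of V - FreeAbelianGroup.of U - FreeAbelianGroup.of W}

/-- The Grothendieck group of the category of finite-length `A`-modules.  (For the special
fibre `A(m)` of a finite free algebra, the finite-length modules over `A` annihilated by
`m` are exactly the finite-dimensional `A(m)`-modules, and equality of classes here is
equivalent to equality in `G₀(A(m))`.) -/
def G0 (A : Type) [Ring A] : Type 1 := FreeAbelianGroup (FLModuleCat A) ⧸ G0Rels A

instance (A : Type) [Ring A] : AddCommGroup (G0 A) :=
  QuotientAddGroup.Quotient.addCommGroup (G0Rels A)

/-- The class of a finite-length `A`-module in `G₀`. -/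
def G0.cls (A : Type) [Ring A] (M : FLModuleCat A) : G0 A :=
  QuotientAddGroup.mk (FreeAbelianGroup.of M)

/-- The submodule `m·N` of (the coercion of) an `A`-stable lattice `N`, where `m` is the
maximal ideal of `O`. -/
def mForm (O A V : Type) [CommRing O] [IsDomain O] [ValuationRing O]
    [Ring A] [Algebra O A] [AddCommGroup V] [Module A V] [Module O V]
    [IsScalarTower O A V] (N : Submodule A V) : Submodule A ↥N :=
  Submodule.span A {x : ↥N | ∃ c ∈ IsLocalRing.maximalIdeal O, ∃ y : ↥N, x = c • y}

theorem bn_cls_exact (A : Type) [Ring A] (U V W : FLModuleCat A) (f : ↑U.1 →ₗ[A] ↑V.1)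
    (g : ↑V.1 →ₗ[A] ↑W.1) (hf : Function.Injective f) (hg : Function.Surjective g)
    (h : LinearMap.range f = LinearMap.ker g) :
    G0.cls A V = G0.cls A U + G0.cls A W := by
  have h0 : FreeAbelianGroup.of V - FreeAbelianGroup.of U - FreeAbelianGroup.of W ∈ G0Rels A :=
    AddSubgroup.subset_closure ⟨U, V, W, f, g, hf, hg, h, rfl⟩
  have h1 := (QuotientAddGroup.eq_zero_iff (N := G0Rels A) _).2 h0
  have h2 : G0.cls A V - G0.cls A U - G0.cls A W = 0 := h1
  rw [sub_sub, sub_eq_zero] at h2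
  exact h2

theorem bn_cls_rangeKer (A : Type) [Ring A] (X Y : Type) [AddCommGroup X] [AddCommGroup Y]
    [Module A X] [Module A Y] (f : X →ₗ[A] Y) (hX : IsFiniteLength A X)
    (hr : IsFiniteLength A (LinearMap.range f)) (hk : IsFiniteLength A (LinearMap.ker f)) :
    G0.cls A ⟨ModuleCat.of A X, hX⟩ =
      G0.cls A ⟨ModuleCat.of A (LinearMap.ker f), hk⟩ +
      G0.cls A ⟨ModuleCat.of A (LinearMap.range f), hr⟩ := by
  refine bn_cls_exact A ⟨ModuleCat.of A (LinearMap.ker f), hk⟩ ⟨ModuleCat.of A X, hX⟩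
    ⟨ModuleCat.of A (LinearMap.range f), hr⟩ (LinearMap.ker f).subtype f.rangeRestrict ?_ ?_ ?_
  · exact Submodule.injective_subtype _
  · exact f.surjective_rangeRestrict
  · simp

theorem bn_cls_congr (A : Type) [Ring A] {X : Type} [AddCommGroup X] [Module A X]
    (p q : Submodule A X) (h : p = q) (hp : IsFiniteLength A p) (hq : IsFiniteLength A q) :
    G0.cls A ⟨ModuleCat.of A p, hp⟩ = G0.cls A ⟨ModuleCat.of A q, hq⟩ := by
  subst h; rfl

/-- A cyclic exact pair of maps identifies classes. -/
theorem bn_cyc (A : Type) [Ring A] (X Y : Type) [AddCommGroup X] [AddCommGroup Y]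
    [Module A X] [Module A Y] (f : X →ₗ[A] Y) (g : Y →ₗ[A] X) (hY : IsFiniteLength A Y)
    (h1 : LinearMap.range f = LinearMap.ker g) (h2 : LinearMap.range g = LinearMap.ker f) :
    ∃ hX : IsFiniteLength A X,
      G0.cls A ⟨ModuleCat.of A X, hX⟩ = G0.cls A ⟨ModuleCat.of A Y, hY⟩ := by
  have hX : IsFiniteLength A X := by
    rw [isFiniteLength_iff_isNoetherian_isArtinian] at hY ⊢
    obtain ⟨_, _⟩ := hY
    exact ⟨isNoetherian_of_range_eq_ker g f h2, isArtinian_of_range_eq_ker g f h2⟩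
  refine ⟨hX, ?_⟩
  have hkf : IsFiniteLength A (LinearMap.ker f) :=
    hX.of_injective (Submodule.injective_subtype _)
  have hkg : IsFiniteLength A (LinearMap.ker g) :=
    hY.of_injective (Submodule.injective_subtype _)
  have hrf : IsFiniteLength A (LinearMap.range f) :=
    hY.of_injective (Submodule.injective_subtype _)
  have hrg : IsFiniteLength A (LinearMap.range g) :=
    hX.of_injective (Submodule.injective_subtype _)
  rw [bn_cls_rangeKer A X Y f hX hrf hkf, bn_cls_rangeKer A Y X g hY hrg hkg, add_comm]
  congr 1
  · exact bn_cls_congr A _ _ h1 _ _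
  · exact bn_cls_congr A _ _ h2.symm _ _

section
set_option linter.unusedSectionVars false
variable {O : Type} [CommRing O] [IsDomain O] [ValuationRing O]
    {K : Type} [Field K] [Algebra O K] [IsFractionRing O K]
    {A : Type} [Ring A] [Algebra O A]
    {V : Type} [AddCommGroup V] [Module K V] [Module A V] [Module O V]
    [IsScalarTower O K V] [IsScalarTower O A V] [SMulCommClass K A V]

theorem bn_v_surj (g : ValuationRing.ValueGroup O K) :
    ∃ x : K, ValuationRing.valuation O K x = g := by
  induction g using Quotient.inductionOn' with
  | h a => exact ⟨a, rfl⟩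

theorem bn_v_le_one (x : K) :
    ValuationRing.valuation O K x ≤ 1 ↔ ∃ a : O, algebraMap O K a = x :=
  ValuationRing.mem_integer_iff O K x

theorem bn_v_lt_one (a : O) :
    ValuationRing.valuation O K (algebraMap O K a) < 1 ↔ a ∈ IsLocalRing.maximalIdeal O := by
  have hle : ValuationRing.valuation O K (algebraMap O K a) ≤ 1 := (bn_v_le_one _).2 ⟨a, rfl⟩
  rw [IsLocalRing.mem_maximalIdeal, mem_nonunits_iff, lt_iff_le_and_ne, and_iff_right hle, not_iff_not]
  constructor
  · intro h
    have ha : algebraMap O K a ≠ 0 := by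
      intro h0; rw [h0, map_zero] at h; exact zero_ne_one h
    obtain ⟨b, hb⟩ := (bn_v_le_one (O := O) (algebraMap O K a)⁻¹).1 (by rw [map_inv₀, h, inv_one])
    refine IsUnit.of_mul_eq_one b ?_
    apply IsFractionRing.injective O K
    rw [map_mul, hb, map_one, mul_inv_cancel₀ ha]
  · rintro ⟨u, rfl⟩
    refine le_antisymm hle ?_
    have h1 : ValuationRing.valuation O K (algebraMap O K (↑u⁻¹ : O)) ≤ 1 :=
      (bn_v_le_one _).2 ⟨_, rfl⟩
    calc (1 : ValuationRing.ValueGroup O K)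
        = ValuationRing.valuation O K (algebraMap O K u) *
          ValuationRing.valuation O K (algebraMap O K (↑u⁻¹ : O)) := by
          rw [← map_mul, ← map_mul, Units.mul_inv, map_one, map_one]
      _ ≤ ValuationRing.valuation O K (algebraMap O K u) * 1 := by gcongr
      _ = _ := mul_one _

variable {ι : Type} [Fintype ι]

/-- The lattice `N` is given by coordinate-wise valuation bounds. -/
def bnDiag (O : Type) [CommRing O] [IsDomain O] [ValuationRing O] {K : Type} [Field K]
    [Algebra O K] [IsFractionRing O K] {V : Type} [AddCommGroup V] [Module K V] {ι : Type}
    (Φ : V ≃ₗ[K] (ι → K)) (N : Set V) (γ : ι → ValuationRing.ValueGroup O K) : Prop :=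
  ∀ x, x ∈ N ↔ ∀ i, ValuationRing.valuation O K (Φ x i) ≤ γ i

theorem bn_osmul (c : O) (y : V) : c • y = algebraMap O K c • y := (algebraMap_smul K c y).symm

theorem bn_mForm_simple (N : Submodule A V) (x : ↥N) :
    x ∈ mForm O A V N ↔ ∃ c ∈ IsLocalRing.maximalIdeal O, ∃ y : ↥N, x = c • y := by
  constructor
  · intro h
    induction h using Submodule.span_induction with
    | mem x h => exact h
    | zero => exact ⟨0, zero_mem _, 0, by simp⟩
    | add x y _ _ hx hy =>
      obtain ⟨c, hc, x', rfl⟩ := hx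
      obtain ⟨d, hd, y', rfl⟩ := hy
      rcases ValuationRing.dvd_total c d with ⟨t, rfl⟩ | ⟨t, rfl⟩
      · exact ⟨c, hc, x' + t • y', by rw [smul_add, mul_smul]⟩
      · exact ⟨d, hd, t • x' + y', by rw [smul_add, mul_smul]⟩
    | smul a x _ hx =>
      obtain ⟨c, hc, x', rfl⟩ := hx
      exact ⟨c, hc, a • x', smul_algebra_smul_comm c a x'⟩
  · intro h
    exact Submodule.subset_span h

theorem bn_mem_mForm (Φ : V ≃ₗ[K] (ι → K)) (N : Submodule A V)
    (γ : ι → ValuationRing.ValueGroup O K) (hγ : ∀ i, γ i ≠ 0) (hN : bnDiag O Φ (N : Set V) γ)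
    (x : ↥N) :
    x ∈ mForm O A V N ↔ ∀ i, ValuationRing.valuation O K (Φ x i) < γ i := by
  classical
  constructor
  · rw [bn_mForm_simple]
    rintro ⟨c, hc, y, rfl⟩ i
    have hy := (hN y).1 y.2 i
    rw [Submodule.coe_smul_of_tower, bn_osmul (K := K), map_smul, Pi.smul_apply, smul_eq_mul, map_mul]
    calc _ ≤ ValuationRing.valuation O K (algebraMap O K c) * γ i := by gcongr
      _ < 1 * γ i := mul_lt_mul_of_pos_right ((bn_v_lt_one c).2 hc) (zero_lt_iff.2 (hγ i))
      _ = _ := one_mul _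
  · intro h
    choose d hd using fun i => bn_v_surj (γ i)
    have hd0 : ∀ i, d i ≠ 0 := fun i h0 => hγ i (by rw [← hd, h0, map_zero])
    have hlt : ∀ i, ValuationRing.valuation O K (Φ x i / d i) < 1 := by
      intro i
      rw [map_div₀, hd, div_lt_one₀ (zero_lt_iff.2 (hγ i))]
      exact h i
    choose c hc using fun i => (bn_v_le_one _).1 (hlt i).le
    have hcm : ∀ i, c i ∈ IsLocalRing.maximalIdeal O := fun i => by
      rw [← bn_v_lt_one (K := K), hc]; exact hlt i
    have hy : ∀ i, Φ.symm (Pi.single i (d i)) ∈ N := fun i => by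
      refine (hN _).2 fun j => ?_
      rw [LinearEquiv.apply_symm_apply]
      by_cases hij : j = i
      · subst hij; simp [hd]
      · simp [hij]
    have hx : x = ∑ i, c i • (⟨Φ.symm (Pi.single i (d i)), hy i⟩ : ↥N) := by
      apply Subtype.ext
      apply Φ.injective
      rw [Submodule.coe_sum, map_sum]
      ext j
      simp only [Submodule.coe_smul_of_tower, fun (c : O) (y : V) => (algebraMap_smul K c y).symm, map_smul, Finset.sum_apply,
        LinearEquiv.apply_symm_apply, Pi.smul_apply, hc, smul_eq_mul]
      rw [Finset.sum_eq_single j]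
      · rw [Pi.single_eq_same, div_mul_cancel₀ _ (hd0 j)]
      · intro b _ hb
        rw [Pi.single_eq_of_ne (Ne.symm hb), mul_zero]
      · simp
    rw [hx]
    exact Submodule.sum_mem _ fun i _ => Submodule.subset_span ⟨c i, hcm i, _, rfl⟩

/-- Multiplication by `k` as a map of reductions. -/
def bnScal (O : Type) [CommRing O] [IsDomain O] [ValuationRing O]
    {K : Type} [Field K] [Algebra O K]
    {A : Type} [Ring A] [Algebra O A]
    {V : Type} [AddCommGroup V] [Module K V] [Module A V] [Module O V]
    [IsScalarTower O K V] [IsScalarTower O A V] [SMulCommClass K A V]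
    (k : K) (L M : Submodule A V) (h : ∀ x ∈ L, k • x ∈ M) :
    (↥L ⧸ mForm O A V L) →ₗ[A] (↥M ⧸ mForm O A V M) :=
  Submodule.mapQ _ _ ((DistribSMul.toLinearMap A V k).restrict h) (by
    rw [mForm, Submodule.span_le]
    rintro x ⟨c, hc, y, rfl⟩
    refine Submodule.subset_span ⟨c, hc, ⟨k • (y : V), h _ y.2⟩, ?_⟩
    apply Subtype.ext
    change k • (c • (y : V)) = c • (k • (y : V))
    rw [← algebraMap_smul K c (y : V), ← algebraMap_smul K c (k • (y : V)), smul_comm])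

theorem bnScal_mk (k : K) (L M : Submodule A V) (h : ∀ x ∈ L, k • x ∈ M) (x : ↥L) :
    bnScal O k L M h (Submodule.Quotient.mk x) = Submodule.Quotient.mk ⟨k • (x : V), h _ x.2⟩ :=
  rfl

theorem bn_base (Φ : V ≃ₗ[K] (ι → K)) (L M : Submodule A V)
    (γ δ : ι → ValuationRing.ValueGroup O K) (hγ : ∀ i, γ i ≠ 0) (hδ : ∀ i, δ i ≠ 0)
    (hL : bnDiag O Φ (L : Set V) γ) (hM : bnDiag O Φ (M : Set V) δ)
    (k : K) (hk : k ≠ 0) (h : ∀ i, γ i = ValuationRing.valuation O K k * δ i)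
    (hY : IsFiniteLength A (↥L ⧸ mForm O A V L)) :
    ∃ hX : IsFiniteLength A (↥M ⧸ mForm O A V M),
      G0.cls A ⟨ModuleCat.of A (↥M ⧸ mForm O A V M), hX⟩ =
      G0.cls A ⟨ModuleCat.of A (↥L ⧸ mForm O A V L), hY⟩ := by
  have hvk : 0 < ValuationRing.valuation O K k := by
    rw [zero_lt_iff]; simpa using hk
  have hs : ∀ x ∈ M, k • x ∈ L := by
    intro x hx
    refine (hL _).2 fun i => ?_
    have := (hM x).1 hx i
    rw [map_smul, Pi.smul_apply, smul_eq_mul, map_mul, h i]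
    gcongr
  refine bn_cyc A _ _ (bnScal O k M L hs) 0 hY ?_ ?_
  · rw [LinearMap.ker_zero, LinearMap.range_eq_top]
    intro y
    obtain ⟨y, rfl⟩ := Submodule.mkQ_surjective _ y
    have hy : k⁻¹ • (y : V) ∈ M := by
      refine (hM _).2 fun i => ?_
      have := (hL y).1 y.2 i
      rw [map_smul, Pi.smul_apply, smul_eq_mul, map_mul, map_inv₀, inv_mul_le_iff₀ hvk, ← h i]
      exact this
    refine ⟨Submodule.Quotient.mk ⟨_, hy⟩, ?_⟩
    rw [bnScal_mk]
    congr 1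
    apply Subtype.ext
    change k • (k⁻¹ • (y : V)) = y
    rw [smul_inv_smul₀ hk]
  · rw [LinearMap.range_zero, eq_comm, LinearMap.ker_eq_bot']
    intro x hx
    obtain ⟨x, rfl⟩ := Submodule.mkQ_surjective _ x
    rw [Submodule.mkQ_apply, bnScal_mk, Submodule.Quotient.mk_eq_zero,
      bn_mem_mForm Φ L γ hγ hL] at hx
    rw [Submodule.mkQ_apply, Submodule.Quotient.mk_eq_zero, bn_mem_mForm Φ M δ hδ hM]
    intro i
    have h1 : ValuationRing.valuation O K (Φ (k • (x : V)) i) < γ i := hx i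
    rw [map_smul, Pi.smul_apply, smul_eq_mul, map_mul, h i] at h1
    exact lt_of_mul_lt_mul_left h1 hvk.le

theorem bn_step (Φ : V ≃ₗ[K] (ι → K)) (L M : Submodule A V)
    (γ δ : ι → ValuationRing.ValueGroup O K) (hγ : ∀ i, γ i ≠ 0) (hδ : ∀ i, δ i ≠ 0)
    (hL : bnDiag O Φ (L : Set V) γ) (hM : bnDiag O Φ (M : Set V) δ)
    (a : K) (ha : a ≠ 0) (ha1 : ValuationRing.valuation O K a < 1)
    (h : ∀ i, δ i = γ i ∨ δ i = ValuationRing.valuation O K a * γ i)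
    (hY : IsFiniteLength A (↥L ⧸ mForm O A V L)) :
    ∃ hX : IsFiniteLength A (↥M ⧸ mForm O A V M),
      G0.cls A ⟨ModuleCat.of A (↥M ⧸ mForm O A V M), hX⟩ =
      G0.cls A ⟨ModuleCat.of A (↥L ⧸ mForm O A V L), hY⟩ := by
  classical
  have hva : 0 < ValuationRing.valuation O K a := by
    rw [zero_lt_iff]; simpa using ha
  have hlt : ∀ i, ValuationRing.valuation O K a * γ i < γ i := fun i =>
    mul_lt_of_lt_one_left (zero_lt_iff.2 (hγ i)) ha1
  have hs1 : ∀ x ∈ M, (1 : K) • x ∈ L := by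
    intro x hx
    rw [one_smul]
    refine (hL _).2 fun i => ((hM x).1 hx i).trans ?_
    rcases h i with h | h
    · exact h.le
    · rw [h]; exact (hlt i).le
  have hs2 : ∀ x ∈ L, a • x ∈ M := by
    intro x hx
    refine (hM _).2 fun i => ?_
    have h1 := (hL x).1 hx i
    rw [map_smul, Pi.smul_apply, smul_eq_mul, map_mul]
    have h2 : ValuationRing.valuation O K a * ValuationRing.valuation O K (Φ x i) ≤
      ValuationRing.valuation O K a * γ i := by gcongr
    rcases h i with h | h
    · rw [h]; exact h2.trans (hlt i).le
    · rw [h]; exact h2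
  have hmL := bn_mem_mForm Φ L γ hγ hL
  have hmM := bn_mem_mForm Φ M δ hδ hM
  refine bn_cyc A _ _ (bnScal O 1 M L hs1) (bnScal O a L M hs2) hY ?_ ?_
  · apply le_antisymm
    · rintro _ ⟨x, rfl⟩
      obtain ⟨x, rfl⟩ := Submodule.mkQ_surjective _ x
      rw [LinearMap.mem_ker, Submodule.mkQ_apply, bnScal_mk, bnScal_mk, Submodule.Quotient.mk_eq_zero, hmM]
      intro i
      change ValuationRing.valuation O K (Φ (a • (1 : K) • (x : V)) i) < δ i
      have h1 := (hM x).1 x.2 i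
      rw [one_smul, map_smul, Pi.smul_apply, smul_eq_mul, map_mul]
      calc _ ≤ ValuationRing.valuation O K a * δ i := by gcongr
        _ < _ := mul_lt_of_lt_one_left (zero_lt_iff.2 (hδ i)) ha1
    · intro y hy
      obtain ⟨y, rfl⟩ := Submodule.mkQ_surjective _ y
      rw [LinearMap.mem_ker, Submodule.mkQ_apply, bnScal_mk,
        Submodule.Quotient.mk_eq_zero, hmM] at hy
      have hy' : ∀ i, ValuationRing.valuation O K (Φ (a • (y : V)) i) < δ i := hy
      have hx : Φ.symm (fun i => if δ i = γ i then Φ (y : V) i else 0) ∈ M := by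
        refine (hM _).2 fun i => ?_
        rw [LinearEquiv.apply_symm_apply]
        split_ifs with hi
        · rw [hi]; exact (hL y).1 y.2 i
        · simp
      refine ⟨Submodule.Quotient.mk ⟨_, hx⟩, ?_⟩
      rw [Submodule.mkQ_apply, bnScal_mk, Submodule.Quotient.eq, hmL]
      intro i
      change ValuationRing.valuation O K (Φ ((1 : K) •
        Φ.symm (fun i => if δ i = γ i then Φ (y : V) i else 0) - (y : V)) i) < γ i
      rw [one_smul, map_sub, Pi.sub_apply, LinearEquiv.apply_symm_apply]
      split_ifs with hi
      · rw [sub_self, map_zero]; exact zero_lt_iff.2 (hγ i)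
      · rw [zero_sub, Valuation.map_neg]
        have h3 := hy' i
        rw [map_smul, Pi.smul_apply, smul_eq_mul, map_mul, (h i).resolve_left hi] at h3
        exact lt_of_mul_lt_mul_left h3 hva.le
  · apply le_antisymm
    · rintro _ ⟨x, rfl⟩
      obtain ⟨x, rfl⟩ := Submodule.mkQ_surjective _ x
      rw [LinearMap.mem_ker, Submodule.mkQ_apply, bnScal_mk, bnScal_mk, Submodule.Quotient.mk_eq_zero, hmL]
      intro i
      change ValuationRing.valuation O K (Φ ((1 : K) • a • (x : V)) i) < γ i
      have h1 := (hL x).1 x.2 i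
      rw [one_smul, map_smul, Pi.smul_apply, smul_eq_mul, map_mul]
      calc _ ≤ ValuationRing.valuation O K a * γ i := by gcongr
        _ < _ := hlt i
    · intro y hy
      obtain ⟨y, rfl⟩ := Submodule.mkQ_surjective _ y
      rw [LinearMap.mem_ker, Submodule.mkQ_apply, bnScal_mk,
        Submodule.Quotient.mk_eq_zero, hmL] at hy
      have hy' : ∀ i, ValuationRing.valuation O K (Φ ((1 : K) • (y : V)) i) < γ i := hy
      rw [one_smul] at hy'
      have hx : Φ.symm (fun i => if δ i = γ i then 0 else a⁻¹ * Φ (y : V) i) ∈ L := by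
        refine (hL _).2 fun i => ?_
        rw [LinearEquiv.apply_symm_apply]
        split_ifs with hi
        · simp
        · rw [map_mul, map_inv₀, inv_mul_le_iff₀ hva, ← (h i).resolve_left hi]
          exact (hM y).1 y.2 i
      refine ⟨Submodule.Quotient.mk ⟨_, hx⟩, ?_⟩
      rw [Submodule.mkQ_apply, bnScal_mk, Submodule.Quotient.eq, hmM]
      intro i
      change ValuationRing.valuation O K (Φ (a •
        Φ.symm (fun i => if δ i = γ i then 0 else a⁻¹ * Φ (y : V) i) - (y : V)) i) < δ i
      rw [map_sub, Pi.sub_apply, map_smul, Pi.smul_apply, LinearEquiv.apply_symm_apply]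
      split_ifs with hi
      · rw [smul_zero, zero_sub, Valuation.map_neg, hi]; exact hy' i
      · rw [smul_eq_mul, mul_inv_cancel_left₀ ha, sub_self, map_zero]
        exact zero_lt_iff.2 (hδ i)

theorem bn_ind (Φ : V ≃ₗ[K] (ι → K)) (M : Submodule A V)
    (δ : ι → ValuationRing.ValueGroup O K) (hδ : ∀ i, δ i ≠ 0)
    (hM : bnDiag O Φ (M : Set V) δ) [DecidableEq (ValuationRing.ValueGroup O K)] (n : ℕ) :
    ∀ (L : Submodule A V) (γ : ι → ValuationRing.ValueGroup O K), (∀ i, γ i ≠ 0) →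
    bnDiag O Φ (L : Set V) γ → (Finset.univ.image (fun i => γ i / δ i)).card ≤ n →
    ∀ hY : IsFiniteLength A (↥L ⧸ mForm O A V L),
    ∃ hX : IsFiniteLength A (↥M ⧸ mForm O A V M),
      G0.cls A ⟨ModuleCat.of A (↥M ⧸ mForm O A V M), hX⟩ =
      G0.cls A ⟨ModuleCat.of A (↥L ⧸ mForm O A V L), hY⟩ := by
  induction n with
  | zero =>
    intro L γ hγ hL hcard hY
    have he : ∀ i : ι, False := by
      intro i
      have h0 := Finset.card_eq_zero.1 (Nat.le_zero.1 hcard)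
      have h1 : γ i / δ i ∈ (∅ : Finset (ValuationRing.ValueGroup O K)) := by
        rw [← h0]; exact Finset.mem_image_of_mem _ (Finset.mem_univ i)
      simp at h1
    exact bn_base Φ L M γ δ hγ hδ hL hM 1 one_ne_zero (fun i => (he i).elim) hY
  | succ n ih =>
    intro L γ hγ hL hcard hY
    set S := Finset.univ.image (fun i => γ i / δ i) with hS
    have hmem : ∀ i, γ i / δ i ∈ S := fun i => Finset.mem_image_of_mem _ (Finset.mem_univ i)
    have hS0 : ∀ c ∈ S, c ≠ 0 := by
      intro c hc
      obtain ⟨i, _, rfl⟩ := Finset.mem_image.1 hc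
      exact div_ne_zero (hγ i) (hδ i)
    by_cases hne : S.Nonempty
    swap
    · rw [Finset.not_nonempty_iff_eq_empty] at hne
      exact ih L γ hγ hL (by rw [← hS, hne]; simp) hY
    set c := S.max' hne with hc
    have hcS : c ∈ S := S.max'_mem hne
    obtain ⟨k, hk⟩ := bn_v_surj (K := K) c
    have hk0 : k ≠ 0 := fun h0 => hS0 c hcS (by rw [← hk, h0, map_zero])
    by_cases hne' : (S.erase c).Nonempty
    swap
    · rw [Finset.not_nonempty_iff_eq_empty] at hne'
      refine bn_base Φ L M γ δ hγ hδ hL hM k hk0 (fun i => ?_) hY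
      have : γ i / δ i = c := by
        by_contra h
        have h1 := Finset.mem_erase.2 ⟨h, hmem i⟩
        rw [hne'] at h1
        simp at h1
      rw [hk, ← this, div_mul_cancel₀ _ (hδ i)]
    set c' := (S.erase c).max' hne' with hc'
    have hcS' : c' ∈ S.erase c := Finset.max'_mem _ hne'
    have hc'S : c' ∈ S := Finset.mem_of_mem_erase hcS'
    have hlt : c' < c := lt_of_le_of_ne (S.le_max' _ hc'S) (Finset.ne_of_mem_erase hcS')
    have hc0 : 0 < c := zero_lt_iff.2 (hS0 c hcS)
    have hc'0 : 0 < c' := zero_lt_iff.2 (hS0 c' hc'S)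
    obtain ⟨k', hk'⟩ := bn_v_surj (K := K) c'
    have hk'0 : k' ≠ 0 := fun h0 => hS0 c' hc'S (by rw [← hk', h0, map_zero])
    let N : Submodule A V := L ⊓ M.comap (DistribSMul.toLinearMap A V k'⁻¹)
    let γ' : ι → ValuationRing.ValueGroup O K := fun i => min (γ i) (c' * δ i)
    have hN : bnDiag O Φ (N : Set V) γ' := by
      intro x
      have h1 : x ∈ (N : Set V) ↔ x ∈ (L : Set V) ∧ k'⁻¹ • x ∈ (M : Set V) := Iff.rfl
      rw [h1, hL, hM, ← forall_and]
      refine forall_congr' fun i => ?_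
      rw [map_smul, Pi.smul_apply, smul_eq_mul, map_mul, map_inv₀, hk', inv_mul_le_iff₀ hc'0]
      exact le_min_iff.symm
    have hγ' : ∀ i, γ' i ≠ 0 := by
      intro i
      rcases min_choice (γ i) (c' * δ i) with h | h
      · change min (γ i) (c' * δ i) ≠ 0
        rw [h]; exact hγ i
      · change min (γ i) (c' * δ i) ≠ 0
        rw [h]; exact mul_ne_zero hc'0.ne' (hδ i)
    have hdich : ∀ i, γ i / δ i ≤ c' ∨ γ i / δ i = c := by
      intro i
      by_cases h : γ i / δ i = c
      · exact Or.inr h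
      · exact Or.inl (Finset.le_max' _ _ (Finset.mem_erase.2 ⟨h, hmem i⟩))
    have hle : ∀ i, γ i / δ i ≤ c' → γ' i = γ i := by
      intro i h
      exact min_eq_left ((div_le_iff₀ (zero_lt_iff.2 (hδ i))).1 h)
    have heq : ∀ i, γ i / δ i = c → γ' i = c' * δ i := by
      intro i h
      refine min_eq_right ?_
      rw [div_eq_iff (hδ i)] at h
      rw [h]
      gcongr
    obtain ⟨hZ, hZe⟩ := bn_step Φ L N γ γ' hγ hγ' hL hN (k' / k) (div_ne_zero hk'0 hk0)
      (by rw [map_div₀, hk, hk']; exact (div_lt_one₀ hc0).2 hlt)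
      (fun i => by
        rcases hdich i with h | h
        · exact Or.inl (hle i h)
        · right
          rw [heq i h, map_div₀, hk, hk', (div_eq_iff (hδ i)).1 h, ← mul_assoc,
            div_mul_cancel₀ _ hc0.ne']) hY
    obtain ⟨hX, hXe⟩ := ih N γ' hγ' hN (by
      have hsub : Finset.univ.image (fun i => γ' i / δ i) ⊆ S.erase c := by
        intro d hd
        obtain ⟨i, _, rfl⟩ := Finset.mem_image.1 hd
        rcases hdich i with h | h
        · rw [hle i h]
          exact Finset.mem_erase.2 ⟨(h.trans_lt hlt).ne, hmem i⟩
        · rw [heq i h, mul_div_cancel_right₀ _ (hδ i)]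
          exact hcS'
      have h1 := Finset.card_le_card hsub
      have h2 := Finset.card_erase_lt_of_mem hcS
      omega) hZ
    exact ⟨hX, hXe.trans hZe⟩

end

section
set_option linter.unusedSectionVars false
variable {O : Type} [CommRing O] [IsDomain O] [ValuationRing O]
    {K : Type} [Field K] [Algebra O K] [IsFractionRing O K]

theorem bn_basis {V : Type} [AddCommGroup V] [Module K V] [Module O V] [IsScalarTower O K V]
    (M : Submodule O V) (hM : M.FG) (hspan : Submodule.span K (M : Set V) = ⊤) :
    ∃ (κ : Type) (_ : Fintype κ) (b : Module.Basis κ K V),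
      ∀ x, x ∈ M ↔ ∀ i, ValuationRing.valuation O K (b.repr x i) ≤ 1 := by
  classical
  have hfin : Module.Finite O M := Module.Finite.iff_fg.2 hM
  have htf : Submodule.torsion O M = ⊥ := by
    rw [eq_bot_iff]
    rintro x ⟨⟨r, hr⟩, h⟩
    have hr0 : algebraMap O K r ≠ 0 := by
      intro h0
      exact nonZeroDivisors.ne_zero hr (IsFractionRing.injective O K (h0.trans (map_zero _).symm))
    have h1 : r • (x : V) = 0 := congrArg Subtype.val h
    rw [← algebraMap_smul K r (x : V), smul_eq_zero] at h1
    exact Subtype.ext (h1.resolve_left hr0)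
  have hflat : Module.Flat O M := Module.Flat.flat_iff_torsion_eq_bot_of_isBezout.2 htf
  have hfree : Module.Free O M := Module.free_of_flat_of_isLocalRing
  let b0 := Module.Free.chooseBasis O M
  have hli : LinearIndependent O (fun i => (b0 i : V)) :=
    b0.linearIndependent.map' M.subtype (Submodule.ker_subtype M)
  have hliK : LinearIndependent K (fun i => (b0 i : V)) :=
    (LinearIndependent.iff_fractionRing O K).1 hli
  have hsp : ⊤ ≤ Submodule.span K (Set.range fun i => (b0 i : V)) := by
    rw [← hspan, Submodule.span_le]
    intro x hx
    have h1 : x = ∑ i, b0.repr ⟨x, hx⟩ i • (b0 i : V) := by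
      have := congrArg M.subtype (b0.sum_repr ⟨x, hx⟩)
      rw [map_sum] at this
      exact this.symm
    rw [h1]
    refine Submodule.sum_mem _ fun i _ => ?_
    rw [← algebraMap_smul K]
    exact Submodule.smul_mem _ _ (Submodule.subset_span ⟨i, rfl⟩)
  let b := Module.Basis.mk hliK hsp
  have hb : ∀ i, b i = (b0 i : V) := fun i => Module.Basis.mk_apply hliK hsp i
  refine ⟨_, inferInstance, b, fun x => ⟨fun hx i => ?_, fun h => ?_⟩⟩
  · have h1 : x = ∑ i, algebraMap O K (b0.repr ⟨x, hx⟩ i) • b i := by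
      have := congrArg M.subtype (b0.sum_repr ⟨x, hx⟩)
      rw [map_sum] at this
      refine (show _ = x from this).symm.trans ?_
      refine Finset.sum_congr rfl fun j _ => ?_
      rw [hb, algebraMap_smul]
      rfl
    rw [h1, Module.Basis.repr_sum_self]
    exact (bn_v_le_one _).2 ⟨_, rfl⟩
  · choose c hc using fun i => (bn_v_le_one _).1 (h i)
    rw [← b.sum_repr x]
    refine Submodule.sum_mem _ fun i _ => ?_
    rw [← hc, algebraMap_smul, hb]
    exact M.smul_mem _ (b0 i).2

theorem bn_adapted (n : ℕ) :
    ∀ (V : Type) [AddCommGroup V] [Module K V] [Module O V] [IsScalarTower O K V]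
      [FiniteDimensional K V] (_ : Module.finrank K V = n)
      (L M : Submodule O V), L.FG → M.FG → Submodule.span K (L : Set V) = ⊤ →
      Submodule.span K (M : Set V) = ⊤ →
      ∃ (Φ : V ≃ₗ[K] (Fin n → K)) (γ δ : Fin n → ValuationRing.ValueGroup O K),
        (∀ i, γ i ≠ 0) ∧ (∀ i, δ i ≠ 0) ∧ bnDiag O Φ (L : Set V) γ ∧
          bnDiag O Φ (M : Set V) δ := by
  induction n with
  | zero =>
    intro V _ _ _ _ _ hn L M _ _ _ _
    have hs : Subsingleton V := Module.finrank_zero_iff.1 hn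
    refine ⟨LinearEquiv.ofFinrankEq V (Fin 0 → K) (by simp [hn]), fun _ => 1, fun _ => 1,
      fun i => i.elim0, fun i => i.elim0, fun x => ⟨fun _ i => i.elim0, fun _ => ?_⟩,
      fun x => ⟨fun _ i => i.elim0, fun _ => ?_⟩⟩
    · rw [Subsingleton.elim x 0]; exact L.zero_mem
    · rw [Subsingleton.elim x 0]; exact M.zero_mem
  | succ n ih =>
    intro V _ _ _ _ _ hn L M hLfg hMfg hLs hMs
    classical
    obtain ⟨κ, _, b, hb⟩ := bn_basis M hMfg hMs
    obtain ⟨s, hs⟩ := hLfg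
    have hnt : Nontrivial V := Module.nontrivial_of_finrank_pos (R := K) (by omega)
    have hspan0 : ¬ ∀ g ∈ s, g = 0 := by
      intro h
      have h1 : L ≤ ⊥ := by
        rw [← hs, Submodule.span_le]
        intro g hg
        exact h g hg
      have h2 : (⊤ : Submodule K V) ≤ ⊥ := by
        rw [← hLs, Submodule.span_le]
        intro g hg
        exact h1 hg
      exact bot_ne_top (le_bot_iff.1 h2).symm
    push Not at hspan0
    obtain ⟨g0, hg0, hg00⟩ := hspan0
    have hi0 : ∃ i, b.repr g0 i ≠ 0 := by
      by_contra! h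
      exact hg00 (b.repr.map_eq_zero_iff.1 (Finsupp.ext h))
    obtain ⟨i0', hi0'⟩ := hi0
    obtain ⟨⟨i0, g⟩, hmem, hmax⟩ := Finset.exists_max_image (Finset.univ ×ˢ s)
      (fun q : κ × V => ValuationRing.valuation O K (b.repr q.2 q.1))
      ⟨(i0', g0), Finset.mem_product.2 ⟨Finset.mem_univ _, hg0⟩⟩
    have hgs : g ∈ s := (Finset.mem_product.1 hmem).2
    have hgL : g ∈ L := by rw [← hs]; exact Submodule.subset_span hgs
    set p := b.repr g i0 with hp
    have hmax' : ∀ i, ∀ x ∈ s, ValuationRing.valuation O K (b.repr x i) ≤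
        ValuationRing.valuation O K p := fun i x hx =>
      hmax (i, x) (Finset.mem_product.2 ⟨Finset.mem_univ _, hx⟩)
    have hp0 : p ≠ 0 := by
      intro h
      have h1 := hmax' i0' g0 hg0
      rw [h, map_zero, le_zero_iff] at h1
      exact hi0' ((map_eq_zero _).1 h1)
    have hvp : 0 < ValuationRing.valuation O K p := by
      rw [zero_lt_iff]; simpa using hp0
    let lam : V →ₗ[K] K := b.coord i0
    have hlamg : lam g = p := rfl
    have hLle : ∀ x ∈ L, ValuationRing.valuation O K (lam x) ≤ ValuationRing.valuation O K p := by
      intro x hx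
      rw [← hs] at hx
      induction hx using Submodule.span_induction with
      | mem x hx => exact hmax' i0 x hx
      | zero => rw [map_zero, map_zero]; exact zero_le
      | add x y _ _ hx hy =>
        rw [map_add]
        exact (Valuation.map_add _ _ _).trans (max_le hx hy)
      | smul a x _ hx =>
        rw [← algebraMap_smul K, map_smul, smul_eq_mul, map_mul]
        have h1 : ValuationRing.valuation O K (algebraMap O K a) ≤ 1 := (bn_v_le_one _).2 ⟨a, rfl⟩
        calc _ ≤ 1 * ValuationRing.valuation O K p := by gcongr
          _ = _ := one_mul _
    have hsmulmem : ∀ (N : Submodule O V) (k : K) (x : V), ValuationRing.valuation O K k ≤ 1 →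
        x ∈ N → k • x ∈ N := by
      intro N k x hk hx
      obtain ⟨a, rfl⟩ := (bn_v_le_one _).1 hk
      rw [algebraMap_smul]
      exact N.smul_mem _ hx
    let e : V := p⁻¹ • g
    have heM : e ∈ M := by
      refine (hb _).2 fun i => ?_
      change ValuationRing.valuation O K (b.repr (p⁻¹ • g) i) ≤ 1
      rw [map_smul, Finsupp.smul_apply, smul_eq_mul, map_mul, map_inv₀, inv_mul_le_iff₀ hvp, mul_one]
      exact hmax' i g hgs
    have hlame : lam e = 1 := by
      change lam (p⁻¹ • g) = 1
      rw [map_smul, hlamg, smul_eq_mul, inv_mul_cancel₀ hp0]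
    have heL : ∀ k : K, ValuationRing.valuation O K k ≤ ValuationRing.valuation O K p →
        k • e ∈ L := by
      intro k hk
      change k • (p⁻¹ • g) ∈ L
      rw [smul_smul]
      refine hsmulmem L _ _ ?_ hgL
      rw [← div_eq_mul_inv, map_div₀]
      exact div_le_one_of_le₀ hk zero_le
    let W : Submodule K V := LinearMap.ker lam
    let π : V →ₗ[K] W := LinearMap.codRestrict W (LinearMap.id - lam.smulRight e) (by
      intro x
      change lam (x - lam x • e) = 0
      rw [map_sub, map_smul, hlame, smul_eq_mul, mul_one, sub_self])
    have hπ : ∀ x, (π x : V) = x - lam x • e := fun x => rfl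
    have hπW : ∀ w : W, π w = w := by
      intro w
      apply Subtype.ext
      have : lam w = 0 := w.2
      rw [hπ, this, zero_smul, sub_zero]
    have hsurj : Function.Surjective π := fun w => ⟨w, hπW w⟩
    have hmap : ∀ N : Submodule O V, (∀ x ∈ N, lam x • e ∈ N) →
        ∀ w : W, w ∈ N.map (π.restrictScalars O) ↔ (w : V) ∈ N := by
      intro N hN w
      constructor
      · rintro ⟨x, hx, rfl⟩
        change (π x : V) ∈ N
        rw [hπ]
        exact N.sub_mem hx (hN x hx)
      · intro hw
        exact ⟨w, hw, hπW w⟩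
    have hspanmap : ∀ N : Submodule O V, Submodule.span K (N : Set V) = ⊤ →
        Submodule.span K ((N.map (π.restrictScalars O) : Submodule O W) : Set W) = ⊤ := by
      intro N hN
      have : ((N.map (π.restrictScalars O) : Submodule O W) : Set W) = π '' (N : Set V) := rfl
      rw [this, Submodule.span_image, hN, Submodule.map_top, LinearMap.range_eq_top]
      exact hsurj
    have hML : ∀ x ∈ L, lam x • e ∈ L := fun x hx => heL _ (hLle x hx)
    have hMM : ∀ x ∈ M, lam x • e ∈ M := fun x hx => hsmulmem M _ _ ((hb x).1 hx i0) heM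
    have hrank : Module.finrank K W = n := by
      have h1 := LinearMap.finrank_range_add_finrank_ker lam
      have h2 : LinearMap.range lam = ⊤ := by
        rw [LinearMap.range_eq_top]
        intro k
        exact ⟨k • e, by rw [map_smul, hlame, smul_eq_mul, mul_one]⟩
      rw [h2, finrank_top, Module.finrank_self, hn] at h1
      change Module.finrank K (LinearMap.ker lam) = n
      omega
    obtain ⟨Φ', γ', δ', hγ', hδ', hL', hM'⟩ := ih W hrank (L.map (π.restrictScalars O))
      (M.map (π.restrictScalars O)) (Submodule.FG.map _ ⟨s, hs⟩) (Submodule.FG.map _ hMfg)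
      (hspanmap L hLs) (hspanmap M hMs)
    let Φ0 : V →ₗ[K] (Fin (n + 1) → K) :=
      (Fin.consLinearEquiv K (fun _ : Fin (n + 1) => K)).toLinearMap ∘ₗ
        (lam.prod (Φ'.toLinearMap ∘ₗ π))
    have hΦ00 : ∀ x, Φ0 x 0 = lam x := fun x => rfl
    have hΦ0s : ∀ x i, Φ0 x (Fin.succ i) = Φ' (π x) i := fun x i => rfl
    have hinj : Function.Injective Φ0 := by
      rw [injective_iff_map_eq_zero]
      intro x hx
      have h1 : lam x = 0 := by rw [← hΦ00, hx]; rfl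
      have h2 : π x = 0 := by
        apply Φ'.injective
        rw [map_zero]
        ext i
        rw [← hΦ0s, hx]; rfl
      have h3 := hπ x
      rw [h2, h1, zero_smul, sub_zero] at h3
      exact h3.symm
    let Φ : V ≃ₗ[K] (Fin (n + 1) → K) :=
      LinearEquiv.ofInjectiveOfFinrankEq Φ0 hinj (by simp [hn])
    have hΦ : ∀ x, Φ x = Φ0 x := fun x => rfl
    have hdec : ∀ (N : Submodule O V) (r : ValuationRing.ValueGroup O K)
        (ε : Fin n → ValuationRing.ValueGroup O K),
        (∀ x ∈ N, ValuationRing.valuation O K (lam x) ≤ r) →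
        (∀ k : K, ValuationRing.valuation O K k ≤ r → k • e ∈ N) →
        bnDiag O Φ' ((N.map (π.restrictScalars O) : Submodule O W) : Set W) ε →
        bnDiag O Φ (N : Set V) (Fin.cons r ε : Fin (n + 1) → ValuationRing.ValueGroup O K) := by
      intro N r ε h1 h2 h3 x
      have hm := hmap N fun x hx => h2 _ (h1 x hx)
      rw [Fin.forall_fin_succ]
      simp only [hΦ, hΦ00, hΦ0s, Fin.cons_zero, Fin.cons_succ]
      rw [← h3 (π x)]
      constructor
      · intro hx
        exact ⟨h1 x hx, ⟨x, hx, rfl⟩⟩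
      · rintro ⟨h4, h5⟩
        have h6 : (π x : V) ∈ N := (hm _).1 h5
        have h7 := N.add_mem h6 (h2 _ h4)
        rw [hπ, sub_add_cancel] at h7
        exact h7
    refine ⟨Φ, Fin.cons (ValuationRing.valuation O K p) γ', Fin.cons 1 δ', ?_, ?_, ?_, ?_⟩
    · intro i
      refine Fin.cases ?_ (fun j => ?_) i
      · exact hvp.ne'
      · exact hγ' j
    · intro i
      refine Fin.cases ?_ (fun j => ?_) i
      · exact one_ne_zero
      · exact hδ' j
    · exact hdec L _ _ hLle heL hL'
    · exact hdec M _ _ (fun x hx => (hb x).1 hx i0) (fun k hk => hsmulmem M _ _ hk heM) hM'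

end

/-- well-definedness of the decomposition map, Brauer–Nesbitt: Let `O` be a
valuation ring with maximal ideal `m` and fraction field `K`, `A` a finite free
`O`-algebra, and let `Vf`, `Wf` be two `O`-free `A`-forms of the same finite-dimensional
`A^K`-module `V`.  Then the reductions `Vf/mVf` and `Wf/mWf` have the same composition
factors with multiplicities, i.e. equal classes in the Grothendieck group of the special
fibre. -/
theorem reduction_classes_well_defined
    (O : Type) [CommRing O] [IsDomain O] [ValuationRing O]
    (K : Type) [Field K] [Algebra O K] [IsFractionRing O K]
    (A : Type) [Ring A] [Algebra O A] [Module.Free O A] [Module.Finite O A]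
    (V : Type) [AddCommGroup V] [Module K V] [Module A V] [Module O V]
    [IsScalarTower O K V] [IsScalarTower O A V] [SMulCommClass K A V]
    [FiniteDimensional K V]
    (Vf Wf : Submodule A V)
    (hVfree : Module.Free O (Vf.restrictScalars O))
    (hVfin : Module.Finite O (Vf.restrictScalars O))
    (hVspan : Submodule.span K (Vf : Set V) = ⊤)
    (hWfree : Module.Free O (Wf.restrictScalars O))
    (hWfin : Module.Finite O (Wf.restrictScalars O))
    (hWspan : Submodule.span K (Wf : Set V) = ⊤)
    (hlenV : IsFiniteLength A (↥Vf ⧸ mForm O A V Vf))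
    (hlenW : IsFiniteLength A (↥Wf ⧸ mForm O A V Wf)) :
    G0.cls A ⟨ModuleCat.of A (↥Vf ⧸ mForm O A V Vf), hlenV⟩ =
      G0.cls A ⟨ModuleCat.of A (↥Wf ⧸ mForm O A V Wf), hlenW⟩ := by

  classical
  obtain ⟨Φ, γ, δ, hγ, hδ, hL, hM⟩ := bn_adapted (O := O) (K := K) (Module.finrank K V) V rfl
    (Wf.restrictScalars O) (Vf.restrictScalars O) (Module.Finite.iff_fg.1 hWfin)
    (Module.Finite.iff_fg.1 hVfin) hWspan hVspan
  obtain ⟨_, h⟩ := bn_ind (A := A) Φ Vf δ hδ hM _ Wf γ hγ hL le_rfl hlenW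
  exact h
end
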